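/- Let Γ = Γ_{2,2,2} = {1324, 1423, 123}. Then for all n ≥ 0, U_{Γ,2n}(y) = Σ_{i=0}^{n} ( Π_{j=0}^{n−i−1} (2n−1−2j) )·(−y)^{n+i}, where the empty product (when i = n) equals 1. Equivalently, U_{Γ,2n}(y) = Σ_{i=0}^{n} (2n−1)↓↓_{n−i} (−y)^{n+i}, where (x)↓↓_0 = 1 and (x)↓↓_k = x(x−2)(x−4)⋯(x−2k+2). -/

import Mathlib

open Polynomial

/-- The reduction of a list of distinct integers: replace the i-th smallest entry by i. -/
def redL (l : List ℕ) : List ℕ :=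
  l.map (fun x => (l.countP (fun y => decide (y < x))) + 1)

/-- The number of descents of a list. -/
def desL (l : List ℕ) : ℕ :=
  (l.zip l.tail).countP (fun p => decide (p.2 < p.1))

/-- `σ` has a `Γ`-match: some consecutive factor of length at least 2 reduces to a member of `Γ`. -/
def HasMatch (Γ : Set (List ℕ)) (l : List ℕ) : Prop :=
  ∃ i j : ℕ, 1 ≤ j ∧ i + j + 1 ≤ l.length ∧ redL ((l.drop i).take (j + 1)) ∈ Γ

open scoped Classical in
/-- The set of permutations of `{1,…,n}` (in one-line notation, as lists) with no `Γ`-match. -/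
noncomputable def NMfinset (Γ : Set (List ℕ)) (n : ℕ) : Finset (List ℕ) :=
  ((List.range' 1 n).permutations.toFinset).filter (fun l => ¬ HasMatch Γ l)

/-- `NM_{Γ,n}(y) = Σ_{σ ∈ NM_n(Γ)} y^{1+des(σ)}` for `n ≥ 1`, and `NM_{Γ,0}(y) = 1`. -/
noncomputable def NMpoly (Γ : Set (List ℕ)) (n : ℕ) : Polynomial ℚ :=
  if n = 0 then 1 else ∑ l ∈ NMfinset Γ n, X ^ (1 + desL l)

/-- local condition at the first entry -/
def winC (a : ℕ) : List ℕ → Prop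
  | b :: c :: d :: _ => ¬ (a < b ∧ b < c) ∧ ¬ (a < c ∧ c < b ∧ c < d)
  | [b, c] => ¬ (a < b ∧ b < c)
  | _ => True

def goodL : List ℕ → Prop
  | [] => True
  | a :: l => winC a l ∧ goodL l

def startDD : List ℕ → Prop
  | a :: b :: c :: _ => b < a ∧ c < b
  | [a, b] => b < a
  | _ => True

lemma desL_nil : desL [] = 0 := rfl
lemma desL_single (a : ℕ) : desL [a] = 0 := rfl
lemma desL_cons (a b : ℕ) (l : List ℕ) :
    desL (a :: b :: l) = (if b < a then 1 else 0) + desL (b :: l) := by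
  simp [desL, List.countP_cons, add_comm]

lemma redL_length (l : List ℕ) : (redL l).length = l.length := by simp [redL]

lemma red3 (a b c : ℕ) : redL [a, b, c] = [1, 2, 3] ↔ (a < b ∧ b < c) := by
  simp only [redL, List.map_cons, List.map_nil, List.countP_cons, List.countP_nil,
    List.cons.injEq, decide_eq_true_eq]
  split_ifs <;> simp <;> omega

lemma red4 (a b c d : ℕ) (h : [a, b, c, d].Nodup) :
    (redL [a, b, c, d] = [1, 3, 2, 4] ∨ redL [a, b, c, d] = [1, 4, 2, 3]) ↔
      (a < c ∧ c < b ∧ c < d) := by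
  have h1 : b ≠ d ∧ a ≠ b ∧ a ≠ c ∧ a ≠ d ∧ b ≠ c ∧ c ≠ d := by
    simp at h; tauto
  obtain ⟨h1, n1, n2, n3, n4, n5⟩ := h1
  clear h
  simp only [redL, List.map_cons, List.map_nil, List.countP_cons, List.countP_nil,
    List.cons.injEq, decide_eq_true_eq]
  constructor
  · intro H
    have Ha := H.elim (fun h => h.1) (fun h => h.1)
    have Hc := H.elim (fun h => h.2.2.1) (fun h => h.2.2.1)
    clear H
    have ha : a < c := by
      by_contra hc
      have : c < a := by omega
      rw [if_pos this] at Ha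
      omega
    rw [if_pos ha] at Hc
    refine ⟨ha, ?_, ?_⟩
    · by_contra hc
      have : b < c := by omega
      rw [if_pos this] at Hc
      omega
    · by_contra hc
      have : d < c := by omega
      rw [if_pos this] at Hc
      omega
  · rintro ⟨h2, h3, h4⟩
    have e1 : ¬ c < a := by omega
    have e2 : ¬ b < a := by omega
    have e3 : ¬ d < a := by omega
    have e4 : ¬ b < c := by omega
    have e5 : ¬ d < c := by omega
    have e6 : a < b := by omega
    have e7 : a < d := by omega
    rcases lt_or_gt_of_ne h1 with h5 | h5
    · have e8 : ¬ d < b := by omega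
      simp [*]
    · have e8 : ¬ b < d := by omega
      simp [*]

def GG : Set (List ℕ) := {[1, 3, 2, 4], [1, 4, 2, 3], [1, 2, 3]}

lemma GG_length {l : List ℕ} (h : redL l ∈ GG) : l.length = 3 ∨ l.length = 4 := by
  rw [← redL_length l]
  rcases h with h | h | h
  · rw [h]; simp
  · rw [h]; simp
  · rw [Set.mem_singleton_iff.mp h]; simp

lemma winC_iff (a : ℕ) (l : List ℕ) (hn : (a :: l).Nodup) :
    winC a l ↔ ¬ ∃ j : ℕ, 1 ≤ j ∧ j + 1 ≤ (a :: l).length ∧ redL ((a :: l).take (j + 1)) ∈ GG := by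
  have key : (∃ j : ℕ, 1 ≤ j ∧ j + 1 ≤ (a :: l).length ∧ redL ((a :: l).take (j + 1)) ∈ GG) ↔
      (2 ≤ l.length ∧ redL ((a :: l).take 3) = [1, 2, 3]) ∨
      (3 ≤ l.length ∧ (redL ((a :: l).take 4) = [1, 3, 2, 4] ∨
        redL ((a :: l).take 4) = [1, 4, 2, 3])) := by
    constructor
    · rintro ⟨j, hj, hl, hm⟩
      have hlen := GG_length hm
      rw [List.length_take] at hlen
      simp only [List.length_cons] at hl hlen
      have h2 := redL_length ((a :: l).take (j + 1))
      rw [List.length_take, List.length_cons] at h2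
      have : j = 2 ∨ j = 3 := by omega
      rcases this with rfl | rfl
      · left
        refine ⟨by omega, ?_⟩
        rcases hm with h | h | h
        · rw [h] at h2; simp at h2; omega
        · rw [h] at h2; simp at h2; omega
        · exact h
      · right
        refine ⟨by omega, ?_⟩
        rcases hm with h | h | h
        · exact Or.inl h
        · exact Or.inr h
        · rw [Set.mem_singleton_iff] at h
          rw [h] at h2; simp at h2; omega
    · rintro (⟨h1, h2⟩ | ⟨h1, h2⟩)
      · exact ⟨2, by omega, by simp; omega, Or.inr (Or.inr h2)⟩
      · refine ⟨3, by omega, by simp; omega, ?_⟩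
        rcases h2 with h2 | h2
        · exact Or.inl h2
        · exact Or.inr (Or.inl h2)
  rw [key]
  match l, hn with
  | [], _ => simp [winC]
  | [b], _ => simp [winC]
  | [b, c], _ => simp [winC, red3]
  | b :: c :: d :: l, hn =>
    have h4 : [a, b, c, d].Nodup := by
      have : [a, b, c, d].Sublist (a :: b :: c :: d :: l) := by simp
      exact this.nodup hn
    have := red4 a b c d h4
    simp only [List.take_succ_cons, List.take_zero, this, red3, winC, List.length_cons]
    have h1 : 2 ≤ l.length + 1 + 1 + 1 := by omega
    have h2 : 3 ≤ l.length + 1 + 1 + 1 := by omega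
    simp only [h1, h2, true_and, not_or]

lemma good_iff (l : List ℕ) (hn : l.Nodup) : goodL l ↔ ¬ HasMatch GG l := by
  induction l with
  | nil => simp [goodL, HasMatch]
  | cons a l ih =>
    rw [goodL, ih (List.nodup_cons.mp hn).2, winC_iff a l hn, ← not_or]
    refine not_congr ?_
    constructor
    · rintro (⟨j, h1, h2, h3⟩ | ⟨i, j, h1, h2, h3⟩)
      · exact ⟨0, j, h1, by omega, by simpa using h3⟩
      · exact ⟨i + 1, j, h1, by simp; omega, by simpa using h3⟩
    · rintro ⟨i, j, h1, h2, h3⟩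
      cases i with
      | zero => exact Or.inl ⟨j, h1, by omega, by simpa using h3⟩
      | succ i => exact Or.inr ⟨i, j, h1, by simp at h2; omega, by simpa using h3⟩

lemma good_append (m : ℕ) (α β : List ℕ) (ha : ∀ x ∈ α, m < x) :
    goodL (α ++ m :: β) ↔ goodL α ∧ goodL (m :: β) := by
  induction α with
  | nil => simp [goodL]
  | cons a α ih =>
    have ih := ih (fun x hx => ha x (by simp [hx]))
    have e1 : goodL (a :: α) ↔ winC a α ∧ goodL α := Iff.rfl
    rw [List.cons_append, goodL, ih, e1, and_assoc]
    refine and_congr_left' ?_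
    have h0 : m < a := ha a (by simp)
    match α, ha with
    | [], _ =>
      match β with
      | [] => simp [winC]
      | [b] => simp [winC]; omega
      | b :: c :: β => simp [winC]; omega
    | [x], ha =>
      have : m < x := ha x (by simp)
      match β with
      | [] => simp [winC]; omega
      | b :: β => simp [winC]; omega
    | [x, y], ha =>
      have : m < y := ha y (by simp)
      simp [winC]; omega
    | x :: y :: z :: α, ha => simp [winC]

lemma good_cons_min (m : ℕ) (β : List ℕ) (hb : ∀ x ∈ β, m < x) (hn : β.Nodup) :
    goodL (m :: β) ↔ startDD β ∧ goodL β := by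
  rw [goodL]
  refine and_congr_left' ?_
  match β, hb, hn with
  | [], _, _ => simp [winC, startDD]
  | [b], _, _ => simp [winC, startDD]
  | [b, c], hb, hn =>
    simp at hb hn
    simp [winC, startDD]; omega
  | b :: c :: d :: β, hb, hn =>
    simp at hb hn
    simp only [winC, startDD]
    omega

lemma des_append (m : ℕ) (α β : List ℕ) (ha : ∀ x ∈ α, m < x) :
    desL (α ++ m :: β) = (if α = [] then 0 else 1 + desL α) + desL (m :: β) := by
  induction α with
  | nil => simp
  | cons a α ih =>
    have ih := ih (fun x hx => ha x (by simp [hx]))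
    have h0 : m < a := ha a (by simp)
    match α with
    | [] => simp [desL_cons, desL_single, h0]
    | x :: α =>
      rw [List.cons_append] at ih ⊢
      rw [List.cons_append, desL_cons, ih, desL_cons a x α]
      simp; omega

lemma des_cons_min (m : ℕ) (β : List ℕ) (hb : ∀ x ∈ β, m < x) :
    desL (m :: β) = desL β := by
  match β with
  | [] => rfl
  | b :: β =>
    have : m < b := hb b (by simp)
    rw [desL_cons, if_neg (by omega), zero_add]

lemma startDD_append (m : ℕ) (a b : ℕ) (α β : List ℕ) (hb : m < b) :
    startDD (a :: b :: α ++ m :: β) ↔ startDD (a :: b :: α) := by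
  match α with
  | [] => simp [startDD, hb]
  | c :: α => simp [startDD]

open scoped Classical in
noncomputable def wN (l : List ℕ) : ℚ[X] :=
  if l = [] then 1 else if goodL l then X ^ (1 + desL l) else 0

open scoped Classical in
noncomputable def wB (l : List ℕ) : ℚ[X] :=
  if l = [] then X else if startDD l ∧ goodL l then X ^ (1 + desL l) else 0

noncomputable def wD (l : List ℕ) : ℚ[X] := if 2 ≤ l.length then wB l else 0
noncomputable def wE (l : List ℕ) : ℚ[X] := 
  if l.length = 0 then X else if l.length = 1 then X ^ 2 else 0
noncomputable def wZ (l : List ℕ) : ℚ[X] := if l.length = 0 then 1 else 0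

lemma wN_append (m : ℕ) (α β : List ℕ) (ha : ∀ x ∈ α, m < x) (hb : ∀ x ∈ β, m < x)
    (hn : β.Nodup) : wN (α ++ m :: β) = wN α * wB β := by
  have h1 : α ++ m :: β ≠ [] := by simp
  rw [wN, wN, wB, if_neg h1, good_append m α β ha, good_cons_min m β hb hn, des_append m α β ha,
    des_cons_min m β hb]
  by_cases e1 : α = []
  · subst e1
    by_cases e2 : β = []
    · subst e2
      simp [goodL, startDD, desL_nil]
    · by_cases e4 : startDD β ∧ goodL β <;> simp [e2, e4, goodL]
  · by_cases e2 : β = []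
    · subst e2
      by_cases e3 : goodL α <;> simp [e1, e3, goodL, startDD, desL_nil]
      ring
    · simp only [e1, e2, if_false]
      by_cases e3 : goodL α <;> by_cases e4 : startDD β ∧ goodL β <;> simp [e3, e4]
      ring

lemma wB_eq_zero (l : List ℕ) (h : l ≠ []) (h2 : ¬ startDD l) : wB l = 0 := by
  rw [wB, if_neg h, if_neg (fun h => h2 h.1)]

lemma wB_append (m : ℕ) (α β : List ℕ) (ha : ∀ x ∈ α, m < x) (hb : ∀ x ∈ β, m < x)
    (hn : β.Nodup) : wB (α ++ m :: β) = wD α * wB β + wE α * wZ β := by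
  have h1 : α ++ m :: β ≠ [] := by simp
  match α, ha with
  | [], _ =>
    match β, hb with
    | [], _ => simp [wB, wD, wE, wZ, startDD, goodL, winC, desL_single]
    | [b], hb =>
      simp at hb
      rw [wB_eq_zero _ (by simp) (by simp [startDD]; omega)]
      simp [wD, wZ]
    | b :: c :: β, hb =>
      simp at hb
      rw [wB_eq_zero _ (by simp) (by simp [startDD]; omega)]
      simp [wD, wZ]
  | [a], ha =>
    simp at ha
    match β, hb with
    | [], _ => simp [wB, wD, wE, wZ, startDD, goodL, winC, desL_single, desL_cons, ha]
    | b :: β, hb =>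
      simp at hb
      rw [wB_eq_zero _ (by simp) (by simp [startDD]; omega)]
      simp [wD, wZ]
  | a :: b :: α, ha =>
    have hbm : m < b := ha b (by simp)
    have h2 : 2 ≤ (a :: b :: α).length := by simp
    have e : wE (a :: b :: α) = 0 := by simp [wE]
    rw [e, zero_mul, add_zero, wD, if_pos h2, wB, if_neg h1, startDD_append m a b α β hbm,
      good_append m _ β ha, good_cons_min m β hb hn, des_append m _ β ha, des_cons_min m β hb,
      wB, wB]
    rw [if_neg (List.cons_ne_nil _ _), if_neg (List.cons_ne_nil _ _)]
    by_cases e2 : β = []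
    · subst e2
      have g1 : goodL [] := trivial
      have g2 : startDD [] := trivial
      by_cases e3 : goodL (a :: b :: α) <;> by_cases e5 : startDD (a :: b :: α) <;>
        simp [e3, e5, g1, g2, desL_nil]
      ring
    · simp only [e2, if_false]
      by_cases e3 : goodL (a :: b :: α) <;> by_cases e5 : startDD (a :: b :: α) <;>
        by_cases e4 : startDD β ∧ goodL β <;> simp [e3, e4, e5]
      ring

def permsOf (s : Finset ℕ) : Finset (List ℕ) := (s.sort (· ≤ ·)).permutations.toFinset

lemma mem_permsOf (s : Finset ℕ) (l : List ℕ) : l ∈ permsOf s ↔ l.Nodup ∧ l.toFinset = s := by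
  rw [permsOf, List.mem_toFinset, List.mem_permutations]
  constructor
  · intro h
    refine ⟨h.nodup_iff.mpr (Finset.sort_nodup _ _), ?_⟩
    rw [List.toFinset_eq_of_perm _ _ h, Finset.sort_toFinset]
  · rintro ⟨h1, h2⟩
    refine List.perm_of_nodup_nodup_toFinset_eq h1 (Finset.sort_nodup _ _) ?_
    rw [Finset.sort_toFinset, h2]

noncomputable def fS (w : List ℕ → ℚ[X]) (s : Finset ℕ) : ℚ[X] := ∑ l ∈ permsOf s, w l

lemma fS_split (w : List ℕ → ℚ[X]) (F : List ℕ → List ℕ → ℚ[X]) (m : ℕ) (s : Finset ℕ)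
    (hm : ∀ x ∈ s, m < x)
    (hw : ∀ α β : List ℕ, (∀ x ∈ α, m < x) → (∀ x ∈ β, m < x) → β.Nodup →
      w (α ++ m :: β) = F α β) :
    fS w (insert m s) = ∑ A ∈ s.powerset, ∑ α ∈ permsOf A, ∑ β ∈ permsOf (s \ A), F α β := by
  have hms : m ∉ s := fun h => lt_irrefl _ (hm m h)
  simp_rw [← Finset.sum_product', Finset.sum_sigma']
  symm
  rw [fS]
  refine Finset.sum_bij (fun p _ => p.2.1 ++ m :: p.2.2) ?_ ?_ ?_ ?_
  · rintro ⟨A, α, β⟩ h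
    simp only [Finset.mem_sigma, Finset.mem_powerset, Finset.mem_product, mem_permsOf] at h
    obtain ⟨hA, ⟨h1, rfl⟩, h2, h3⟩ := h
    rw [mem_permsOf]
    have hmem : ∀ x, x ∈ β ↔ x ∈ s ∧ x ∉ α := by
      intro x
      have := congrArg (fun t => x ∈ t) h3
      simpa using this
    have hA' : ∀ x ∈ α, x ∈ s := fun x hx => hA (by simpa using hx)
    constructor
    · rw [List.nodup_append, List.nodup_cons]
      refine ⟨h1, ⟨fun h => hms ((hmem m).mp h).1, h2⟩, ?_⟩
      intro a ha b hb hab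
      subst hab
      rcases List.mem_cons.mp hb with rfl | hb
      · exact hms (hA' _ ha)
      · exact ((hmem a).mp hb).2 ha
    · ext x
      simp only [List.toFinset_append, List.toFinset_cons, Finset.mem_union, List.mem_toFinset,
        Finset.mem_insert, hmem]
      have := hA' x
      tauto
  · rintro ⟨A, α, β⟩ h ⟨A', α', β'⟩ h' heq
    simp only [Finset.mem_sigma, Finset.mem_powerset, Finset.mem_product, mem_permsOf] at h h'
    obtain ⟨hA, ⟨h1, rfl⟩, h2, h3⟩ := h
    obtain ⟨hA', ⟨h1', rfl⟩, h2', h3'⟩ := h'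
    have ha : m ∉ α := fun h => hms (hA (by simpa using h))
    have ha' : m ∉ α' := fun h => hms (hA' (by simpa using h))
    have hb : m ∉ β := by
      intro h
      have : m ∈ β.toFinset := by simpa using h
      rw [h3] at this
      exact hms (Finset.mem_sdiff.mp this).1
    simp only at heq
    have hb' : m ∉ β' := by
      intro h
      have : m ∈ β'.toFinset := by simpa using h
      rw [h3'] at this
      exact hms (Finset.mem_sdiff.mp this).1
    have hkey : α = α' ∧ β = β' := by
      rcases List.append_eq_append_iff.mp heq with ⟨as, e1, e2⟩ | ⟨as, e1, e2⟩
      · cases as with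
        | nil => simp at e1 e2; exact ⟨e1.symm, e2⟩
        | cons x as =>
          simp at e2
          exact absurd (by rw [e1, ← e2.1]; simp) ha'
      · cases as with
        | nil => simp at e1 e2; exact ⟨e1, e2.symm⟩
        | cons x as =>
          simp at e2
          exact absurd (by rw [e1, ← e2.1]; simp) ha
    obtain ⟨rfl, rfl⟩ := hkey
    rfl
  · intro l hl
    rw [mem_permsOf] at hl
    obtain ⟨h1, h2⟩ := hl
    have hml : m ∈ l := by
      rw [← List.mem_toFinset, h2]; simp
    obtain ⟨α, β, rfl⟩ := List.append_of_mem hml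
    rw [List.nodup_append, List.nodup_cons] at h1
    obtain ⟨h3, ⟨h4, h5⟩, h6⟩ := h1
    have hma : m ∉ α := fun h => h6 m h m (by simp) rfl
    have hmem : ∀ x, (x ∈ α ∨ x = m ∨ x ∈ β) ↔ (x = m ∨ x ∈ s) := by
      intro x
      have : x ∈ (α ++ m :: β).toFinset ↔ x ∈ insert m s := by rw [h2]
      rw [List.mem_toFinset, List.mem_append, List.mem_cons, Finset.mem_insert] at this
      exact this
    refine ⟨⟨α.toFinset, α, β⟩, ?_, rfl⟩
    simp only [Finset.mem_sigma, Finset.mem_powerset, Finset.mem_product, mem_permsOf]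
    refine ⟨?_, ⟨h3, trivial⟩, h5, ?_⟩
    · intro x hx
      rw [List.mem_toFinset] at hx
      have := (hmem x).mp (Or.inl hx)
      rcases this with rfl | h
      · exact absurd hx hma
      · exact h
    · ext x
      simp only [List.mem_toFinset, Finset.mem_sdiff]
      constructor
      · intro hx
        refine ⟨?_, fun h => h6 x h x (by simp [hx]) rfl⟩
        rcases (hmem x).mp (Or.inr (Or.inr hx)) with rfl | h
        · exact absurd hx h4
        · exact h
      · rintro ⟨hx, hx2⟩
        rcases (hmem x).mpr (Or.inr hx) with h | rfl | h
        · exact absurd h hx2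
        · exact absurd hx hms
        · exact h
  · rintro ⟨A, α, β⟩ h
    simp only [Finset.mem_sigma, Finset.mem_powerset, Finset.mem_product, mem_permsOf] at h
    obtain ⟨hA, ⟨h1, rfl⟩, h2, h3⟩ := h
    refine (hw α β ?_ ?_ h2).symm
    · intro x hx
      exact hm x (hA (by simpa using hx))
    · intro x hx
      have : x ∈ β.toFinset := by simpa using hx
      rw [h3] at this
      exact hm x (Finset.mem_sdiff.mp this).1

lemma length_of_mem {s : Finset ℕ} {l : List ℕ} (h : l ∈ permsOf s) : l.length = s.card := by
  rw [mem_permsOf] at h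
  rw [← h.2, List.toFinset_card_of_nodup h.1]

lemma permsOf_empty : permsOf ∅ = {[]} := by
  ext l
  rw [mem_permsOf]
  simp
  rintro rfl
  simp

noncomputable def sB (n : ℕ) : ℚ[X] := fS wB (Finset.range n)
noncomputable def sN (n : ℕ) : ℚ[X] := fS wN (Finset.range n)

lemma fS_prod (w1 w2 : List ℕ → ℚ[X]) (A B : Finset ℕ) :
    ∑ α ∈ permsOf A, ∑ β ∈ permsOf B, w1 α * w2 β = fS w1 A * fS w2 B := by
  rw [fS, fS, Finset.sum_mul_sum]

lemma fS_wD (s : Finset ℕ) : fS wD s = if 2 ≤ s.card then fS wB s else 0 := by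
  rw [fS, fS]
  split_ifs with h
  · refine Finset.sum_congr rfl fun l hl => ?_
    rw [wD, length_of_mem hl, if_pos h]
  · refine Finset.sum_eq_zero fun l hl => ?_
    rw [wD, length_of_mem hl, if_neg h]

lemma fS_wZ (s : Finset ℕ) : fS wZ s = if s.card = 0 then 1 else 0 := by
  split_ifs with h
  · rw [Finset.card_eq_zero.mp h, fS, permsOf_empty]; simp [wZ]
  · refine Finset.sum_eq_zero fun l hl => ?_
    rw [wZ, length_of_mem hl, if_neg h]

lemma permsOf_single (a : ℕ) : permsOf {a} = {[a]} := by
  ext l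
  rw [permsOf, List.mem_toFinset, List.mem_permutations]
  simp

lemma fS_wE (s : Finset ℕ) : fS wE s = if s.card = 0 then X else if s.card = 1 then X ^ 2 else 0 := by
  split_ifs with h h
  · rw [Finset.card_eq_zero.mp h, fS, permsOf_empty]; simp [wE]
  · obtain ⟨a, rfl⟩ := Finset.card_eq_one.mp h
    rw [fS, permsOf_single]; simp [wE]
  · refine Finset.sum_eq_zero fun l hl => ?_
    rw [wE, length_of_mem hl, if_neg (by assumption), if_neg h]

lemma fS_wB_insert (m : ℕ) (s : Finset ℕ) (hm : ∀ x ∈ s, m < x) :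
    fS wB (insert m s) = ∑ A ∈ s.powerset, (fS wD A * fS wB (s \ A) + fS wE A * fS wZ (s \ A)) := by
  rw [fS_split wB _ m s hm (wB_append m)]
  refine Finset.sum_congr rfl fun A _ => ?_
  simp_rw [Finset.sum_add_distrib, fS_prod]

lemma fS_wN_insert (m : ℕ) (s : Finset ℕ) (hm : ∀ x ∈ s, m < x) :
    fS wN (insert m s) = ∑ A ∈ s.powerset, fS wN A * fS wB (s \ A) := by
  rw [fS_split wN _ m s hm (wN_append m)]
  refine Finset.sum_congr rfl fun A _ => ?_
  simp_rw [fS_prod]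

lemma exists_min_split (s : Finset ℕ) (h : s.card ≠ 0) :
    ∃ m t, s = insert m t ∧ (∀ x ∈ t, m < x) ∧ t.card + 1 = s.card := by
  have hne : s.Nonempty := Finset.card_ne_zero.mp h
  refine ⟨s.min' hne, s.erase (s.min' hne), (Finset.insert_erase (s.min'_mem hne)).symm, ?_, ?_⟩
  · intro x hx
    exact s.min'_lt_of_mem_erase_min' hne hx
  · rw [Finset.card_erase_of_mem (s.min'_mem hne)]; omega

noncomputable def bF (b : ℕ → ℚ[X]) (n k : ℕ) : ℚ[X] :=
  (if 2 ≤ k then b k else 0) * b (n - k) +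
    (if k = 0 then X else if k = 1 then X ^ 2 else 0) * (if n - k = 0 then 1 else 0)

lemma fS_wB_card : ∀ n : ℕ, ∀ s t : Finset ℕ, s.card = n → t.card = n → fS wB s = fS wB t := by
  intro n
  induction n using Nat.strong_induction_on with
  | _ n ih =>
  have key : ∀ s : Finset ℕ, s.card = n → n ≠ 0 → fS wB s =
      ∑ k ∈ Finset.range n, (n - 1).choose k • bF sB (n - 1) k := by
    intro s hs hn
    obtain ⟨m, t, rfl, hm, hc⟩ := exists_min_split s (by omega)
    have hc' : t.card = n - 1 := by omega
    rw [fS_wB_insert m t hm]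
    have hh : ∀ A ∈ t.powerset, (fS wD A * fS wB (t \ A) + fS wE A * fS wZ (t \ A)) =
        bF sB (n - 1) A.card := by
      intro A hA
      rw [Finset.mem_powerset] at hA
      have h1 := Finset.card_le_card hA
      have h2 := Finset.card_sdiff_of_subset hA
      rw [fS_wD, fS_wE, fS_wZ, h2, hc', bF, sB, sB]
      rw [ih A.card (by omega) A (Finset.range A.card) rfl (by simp),
        ih (n - 1 - A.card) (by omega) (t \ A) (Finset.range (n - 1 - A.card)) (by omega) (by simp)]
    rw [Finset.sum_congr rfl hh, Finset.sum_powerset_apply_card, hc']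
    congr 2; omega
  intro s t hs ht
  by_cases hn : n = 0
  · rw [hn] at hs ht
    rw [Finset.card_eq_zero.mp hs, Finset.card_eq_zero.mp ht]
  · rw [key s hs hn, key t ht hn]

lemma fS_wB_eq (s : Finset ℕ) : fS wB s = sB s.card :=
  fS_wB_card s.card s _ rfl (by simp)

lemma sB_zero : sB 0 = X := by
  simp [sB, fS, permsOf_empty, wB]

lemma sN_zero : sN 0 = 1 := by
  simp [sN, fS, permsOf_empty, wN]

lemma sB_succ (n : ℕ) : sB (n + 1) = ∑ k ∈ Finset.range (n + 1), n.choose k • bF sB n k := by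
  obtain ⟨m, t, h, hm, hc⟩ := exists_min_split (Finset.range (n + 1)) (by simp)
  rw [Finset.card_range] at hc
  have hc' : t.card = n := by omega
  have h0 : sB (n + 1) = fS wB (insert m t) := by rw [sB, h]
  rw [h0, fS_wB_insert m t hm]
  have hh : ∀ A ∈ t.powerset, (fS wD A * fS wB (t \ A) + fS wE A * fS wZ (t \ A)) =
      bF sB n A.card := by
    intro A hA
    rw [Finset.mem_powerset] at hA
    have h2 := Finset.card_sdiff_of_subset hA
    rw [fS_wD, fS_wE, fS_wZ, fS_wB_eq, fS_wB_eq, h2, hc', bF]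
  rw [Finset.sum_congr rfl hh, Finset.sum_powerset_apply_card, hc']

noncomputable def nF (n k : ℕ) : ℚ[X] := sN k * sB (n - k)

lemma fS_wN_eq : ∀ n : ℕ, ∀ s : Finset ℕ, s.card = n → fS wN s = sN n := by
  intro n
  induction n using Nat.strong_induction_on with
  | _ n ih =>
  have key : ∀ s : Finset ℕ, s.card = n → n ≠ 0 → fS wN s =
      ∑ k ∈ Finset.range n, (n - 1).choose k • (sN k * sB (n - 1 - k)) := by
    intro s hs hn
    obtain ⟨m, t, rfl, hm, hc⟩ := exists_min_split s (by omega)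
    have hc' : t.card = n - 1 := by omega
    rw [fS_wN_insert m t hm]
    have hh : ∀ A ∈ t.powerset, fS wN A * fS wB (t \ A) =
        nF (n - 1) A.card := by
      intro A hA
      rw [Finset.mem_powerset] at hA
      have h1 := Finset.card_le_card hA
      have h2 := Finset.card_sdiff_of_subset hA
      rw [nF, fS_wB_eq, h2, hc', ih A.card (by omega) A rfl]
    rw [Finset.sum_congr rfl hh, Finset.sum_powerset_apply_card, hc']
    simp only [nF]
    congr 2; omega
  intro s hs
  by_cases hn : n = 0
  · rw [hn] at hs
    rw [Finset.card_eq_zero.mp hs, hn]; simp [sN]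
  · rw [key s hs hn, sN, key _ (by simp) hn]

lemma sN_succ (n : ℕ) : sN (n + 1) = ∑ k ∈ Finset.range (n + 1), n.choose k • (sN k * sB (n - k)) := by
  obtain ⟨m, t, h, hm, hc⟩ := exists_min_split (Finset.range (n + 1)) (by simp)
  rw [Finset.card_range] at hc
  have hc' : t.card = n := by omega
  have h0 : sN (n + 1) = fS wN (insert m t) := by rw [sN, h]
  rw [h0, fS_wN_insert m t hm]
  have hh : ∀ A ∈ t.powerset, fS wN A * fS wB (t \ A) =
      nF (n) A.card := by
    intro A hA
    rw [Finset.mem_powerset] at hA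
    have h2 := Finset.card_sdiff_of_subset hA
    rw [nF, fS_wB_eq, h2, hc', fS_wN_eq _ A rfl]
  rw [Finset.sum_congr rfl hh, Finset.sum_powerset_apply_card, hc']
  rfl

lemma NMpoly_eq (n : ℕ) : NMpoly GG n = sN n := by
  rw [NMpoly]
  split_ifs with h
  · rw [h, sN_zero]
  · have hs : permsOf (Finset.Icc 1 n) = (List.range' 1 n).permutations.toFinset := by
      ext l
      rw [mem_permsOf, List.mem_toFinset, List.mem_permutations]
      have e : (List.range' 1 n).toFinset = Finset.Icc 1 n := by
        ext x; simp; omega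
      constructor
      · rintro ⟨h1, h2⟩
        refine List.perm_of_nodup_nodup_toFinset_eq h1 List.nodup_range' ?_
        rw [e, h2]
      · intro hp
        exact ⟨hp.nodup_iff.mpr List.nodup_range', by rw [List.toFinset_eq_of_perm _ _ hp, e]⟩
    rw [← fS_wN_eq n (Finset.Icc 1 n) (by simp), fS, NMfinset, Finset.sum_filter, hs]
    refine Finset.sum_congr rfl fun l hl => ?_
    rw [← hs] at hl
    have hl2 := length_of_mem hl
    have hne : l ≠ [] := by
      rintro rfl
      simp at hl2; omega
    have hg := good_iff l ((mem_permsOf _ _).mp hl).1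
    rw [wN, if_neg hne]
    by_cases hgl : goodL l
    · rw [if_pos hgl, if_pos (hg.mp hgl)]
    · rw [if_neg hgl, if_neg (fun h => hgl (hg.mpr h))]

/-- exponential generating function -/
noncomputable def egf (a : ℕ → ℚ[X]) : PowerSeries ℚ[X] :=
  PowerSeries.mk fun n => ((n.factorial : ℚ)⁻¹) • a n

lemma coeff_egf (a : ℕ → ℚ[X]) (n : ℕ) :
    PowerSeries.coeff n (egf a) = ((n.factorial : ℚ)⁻¹) • a n := by simp [egf]

lemma egf_mul (a b : ℕ → ℚ[X]) :
    egf a * egf b = egf (fun n => ∑ k ∈ Finset.range (n + 1), n.choose k • (a k * b (n - k))) := by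
  ext1 n
  rw [PowerSeries.coeff_mul, coeff_egf, Finset.Nat.sum_antidiagonal_eq_sum_range_succ_mk,
    Finset.smul_sum]
  refine Finset.sum_congr rfl fun k hk => ?_
  have hk : k ≤ n := by simpa [Nat.lt_succ_iff] using hk
  simp only [coeff_egf]
  rw [smul_mul_smul_comm, ← Nat.cast_smul_eq_nsmul ℚ, smul_smul]
  congr 1
  rw [Nat.cast_choose ℚ hk]
  have := Nat.factorial_ne_zero n
  field_simp

lemma psd_mul {R : Type*} [CommRing R] (f g : PowerSeries R) :
    PowerSeries.derivative R (f * g) =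
      f * PowerSeries.derivative R g + g * PowerSeries.derivative R f := by
  rw [Derivation.leibniz, smul_eq_mul, smul_eq_mul]

lemma psd_one {R : Type*} [CommRing R] : PowerSeries.derivative R (1 : PowerSeries R) = 0 :=
  Derivation.map_one_eq_zero _

lemma egf_deriv (a : ℕ → ℚ[X]) :
    PowerSeries.derivative ℚ[X] (egf a) = egf (fun n => a (n + 1)) := by
  ext1 n
  rw [PowerSeries.coeff_derivative, coeff_egf, coeff_egf]
  have h : ((n : ℚ[X]) + 1) = ((n + 1 : ℚ)) • (1 : ℚ[X]) := by
    rw [← Polynomial.C_mul', mul_one]; simp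
  rw [h, smul_mul_smul_comm, mul_one]
  congr 1
  rw [Nat.factorial_succ]
  push_cast
  have := Nat.factorial_ne_zero n
  field_simp

lemma egf_inj {a b : ℕ → ℚ[X]} (h : egf a = egf b) : a = b := by
  funext n
  have := congrArg (PowerSeries.coeff n) h
  rw [coeff_egf, coeff_egf] at this
  have hn : ((n.factorial : ℚ)⁻¹) ≠ 0 := by
    have := Nat.factorial_ne_zero n
    positivity
  exact smul_right_injective _ hn this

lemma egf_add (a b : ℕ → ℚ[X]) : egf a + egf b = egf (fun n => a n + b n) := by
  ext1 n
  simp [coeff_egf]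

lemma egf_const (c : ℚ[X]) : egf (fun n => if n = 0 then c else 0) = PowerSeries.C c := by
  ext1 n
  rw [coeff_egf, PowerSeries.coeff_C]
  split_ifs with h
  · simp [h]
  · simp

lemma egf_lin (c : ℚ[X]) :
    egf (fun n => if n = 1 then c else 0) = PowerSeries.C c * PowerSeries.X := by
  ext1 n
  rw [coeff_egf, PowerSeries.coeff_C_mul, PowerSeries.coeff_X]
  split_ifs with h
  · simp [h]
  · simp

lemma egf_C_mul (c : ℚ[X]) (a : ℕ → ℚ[X]) :
    PowerSeries.C c * egf a = egf (fun n => c * a n) := by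
  ext1 n
  rw [PowerSeries.coeff_C_mul, coeff_egf, coeff_egf, mul_smul_comm]

lemma egf_X_mul (a : ℕ → ℚ[X]) :
    PowerSeries.X * egf a = egf (fun n => (n : ℚ[X]) * a (n - 1)) := by
  ext1 n
  cases n with
  | zero => simp [coeff_egf]
  | succ n =>
    rw [mul_comm, PowerSeries.coeff_succ_mul_X, coeff_egf, coeff_egf]
    have h : (((n + 1 : ℕ) : ℚ[X])) = ((n + 1 : ℚ)) • (1 : ℚ[X]) := by
      rw [← Polynomial.C_mul', mul_one]; simp
    rw [h, smul_mul_assoc, one_mul, smul_smul]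
    simp only [Nat.add_sub_cancel]
    congr 1
    rw [Nat.factorial_succ]
    push_cast
    have := Nat.factorial_ne_zero n
    field_simp

lemma main_rec (u b N : ℕ → ℚ[X]) (hb0 : b 0 = X) (hb1 : b 1 = X) (hu0 : u 0 = 1) (hN0 : N 0 = 1)
    (hb : ∀ n, b (n + 1) = ∑ k ∈ Finset.range (n + 1), n.choose k • bF b n k)
    (hN : ∀ n, N (n + 1) = ∑ k ∈ Finset.range (n + 1), n.choose k • (N k * b (n - k)))
    (hu : ∀ n, 1 ≤ n → ∑ k ∈ Finset.range (n + 1), n.choose k • (u k * N (n - k)) = 0) :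
    ∀ n, u (n + 1) = (-X) ^ (n + 1) - X * ((n : ℚ[X]) * u (n - 1)) := by
  have E1 : egf u * egf N = 1 := by
    rw [egf_mul, ← map_one PowerSeries.C, ← egf_const]
    congr 1
    funext n
    split_ifs with h
    · subst h; simp [hu0, hN0]
    · exact hu n (by omega)
  have E2 : PowerSeries.derivative ℚ[X] (egf N) = egf N * egf b := by
    rw [egf_deriv, egf_mul]
    congr 1
    funext n
    exact hN n
  set y : PowerSeries ℚ[X] := PowerSeries.C X with hy
  set t : PowerSeries ℚ[X] := PowerSeries.X with ht
  have E3 : PowerSeries.derivative ℚ[X] (egf b) =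
      (egf b - y - y * t) * egf b + (y + y ^ 2 * t) := by
    have e1 : egf b = egf (fun k => if 2 ≤ k then b k else 0) + y + y * t := by
      rw [hy, ht, ← egf_lin, ← egf_const, egf_add, egf_add]
      congr 1
      funext n
      rcases n with _ | _ | n
      · simp [hb0]
      · simp [hb1]
      · simp
    have e2 : y + y ^ 2 * t = egf (fun k => if k = 0 then X else if k = 1 then X ^ 2 else 0) *
        egf (fun k => if k = 0 then 1 else 0) := by
      rw [egf_const, map_one, mul_one, hy, ← map_pow, ht, ← egf_lin, ← egf_const, egf_add]
      congr 1
      funext n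
      rcases n with _ | _ | n
      · simp
      · simp
      · simp
    have e3 : egf b - y - y * t = egf (fun k => if 2 ≤ k then b k else 0) := by
      rw [sub_sub, sub_eq_iff_eq_add, ← add_assoc]; exact e1
    rw [e3, e2, egf_mul, egf_mul, egf_add, egf_deriv]
    congr 1
    funext n
    rw [hb n, ← Finset.sum_add_distrib]
    refine Finset.sum_congr rfl fun k _ => ?_
    rw [bF, smul_add]
  have D1 : PowerSeries.derivative ℚ[X] (egf u) = - (egf u * egf b) := by
    have := congrArg (PowerSeries.derivative ℚ[X]) E1
    rw [psd_mul, E2, psd_one] at this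
    linear_combination (egf u) * this - (PowerSeries.derivative ℚ[X] (egf u) + egf u * egf b) * E1
  have dy : PowerSeries.derivative ℚ[X] y = 0 := by
    rw [hy]; exact PowerSeries.derivative_C
  have dt : PowerSeries.derivative ℚ[X] t = 1 := by
    rw [ht]; exact PowerSeries.derivative_X
  have D2 : PowerSeries.derivative ℚ[X] (PowerSeries.derivative ℚ[X] (egf u) + y * (t * egf u)) =
      - (y * (PowerSeries.derivative ℚ[X] (egf u) + y * (t * egf u))) := by
    have := congrArg (PowerSeries.derivative ℚ[X]) D1
    rw [map_neg, psd_mul, E3] at this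
    rw [map_add, this, psd_mul, psd_mul, dy, dt, D1]
    ring
  rw [egf_deriv, hy, ht, egf_X_mul, egf_C_mul, egf_add, egf_deriv, egf_C_mul] at D2
  have D3 := egf_inj (a := fun n => u (n + 1 + 1) + X * (((n + 1 : ℕ) : ℚ[X]) * u (n + 1 - 1)))
    (b := fun n => - (X * (u (n + 1) + X * ((n : ℚ[X]) * u (n - 1))))) (by
      rw [D2]
      ext1 n
      simp [coeff_egf])
  have D4 : ∀ n, u (n + 1) + X * ((n : ℚ[X]) * u (n - 1)) = (-X) ^ (n + 1) := by
    intro n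
    induction n with
    | zero =>
      have h1 := hu 1 le_rfl
      have h2 := hN 0
      simp [Finset.sum_range_succ, hu0, hN0, hb0] at h1 h2
      simp
      rw [h2] at h1
      linear_combination h1
    | succ n ih =>
      have : u (n + 1 + 1) + X * (((n + 1 : ℕ) : ℚ[X]) * u (n + 1 - 1)) =
          - (X * (u (n + 1) + X * ((n : ℚ[X]) * u (n - 1)))) := congrFun D3 n
      rw [this, ih]; ring
  intro n
  rw [← D4 n]; ring

theorem stmt7 (Γ : Set (List ℕ)) (hΓ : Γ = {[1, 3, 2, 4], [1, 4, 2, 3], [1, 2, 3]})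
    (U : ℤ → Polynomial ℚ)
    (hUneg : ∀ m : ℤ, m < 0 → U m = 0)
    (hU0 : U 0 = 1)
    (hUrec : ∀ n : ℕ, 1 ≤ n →
      ∑ k ∈ Finset.range (n + 1), (n.choose k : ℚ) • (U (k : ℤ) * NMpoly Γ (n - k)) = 0) :
    ∀ n : ℕ,
      U ((2 * n : ℕ) : ℤ) = ∑ i ∈ Finset.range (n + 1),
        ((∏ j ∈ Finset.range (n - i), (2 * n - 1 - 2 * j) : ℕ) : Polynomial ℚ) *
          (-X : Polynomial ℚ) ^ (n + i) := by
  subst hΓ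
  have h1 := main_rec (fun n => U (n : ℤ)) sB sN sB_zero
    (by rw [sB_succ]; simp [bF]) (by simpa using hU0) sN_zero sB_succ sN_succ
    (by
      intro n hn
      rw [← hUrec n hn]
      refine Finset.sum_congr rfl fun k _ => ?_
      rw [Nat.cast_smul_eq_nsmul ℚ, ← NMpoly_eq]
      rfl)
  intro n
  induction n with
  | zero => simp [hU0]
  | succ n ih =>
    have h2 := h1 (2 * n + 1)
    simp only [Nat.add_sub_cancel] at h2
    rw [show 2 * (n + 1) = 2 * n + 1 + 1 by ring, h2, ih, Finset.sum_range_succ _ (n + 1)]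
    rw [Finset.mul_sum, Finset.mul_sum, sub_eq_add_neg, add_comm, ← Finset.sum_neg_distrib]
    congr 1
    · refine Finset.sum_congr rfl fun i hi => ?_
      have hi : i ≤ n := by simpa [Nat.lt_succ_iff] using hi
      rw [show n + 1 - i = (n - i) + 1 by omega, Finset.prod_range_succ']
      have : ∀ j, 2 * n + 1 + 1 - 1 - 2 * (j + 1) = 2 * n - 1 - 2 * j := by intro j; omega
      simp only [this]
      rw [show 2 * n + 1 + 1 - 1 - 2 * 0 = 2 * n + 1 by omega]
      push_cast
      ring
    · rw [show n + 1 - (n + 1) = 0 by omega]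
      rw [Finset.prod_range_zero, Nat.cast_one, one_mul]
      congr 1
      ring
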